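/- arXiv:1410.8336 — 2 statements merged into one kernel-verified Lean document; each statement's English description precedes it below -/
import Mathlib

section
/- Let Q be a finite simple graph whose vertex set is A ∪ {w1, w2}, where w1 and w2 are distinct and do not lie in A, and suppose every vertex x of Q other than w1 satisfies deg_Q(x) ≤ |E(Q)| − |A| − 1. Then for every set S of vertices with w1 ∉ S such that Q − S is acyclic, we have |S ∩ (A ∪ {w1, w2})| ≥ 2. (Key counting claim in the proof of correctness of Rule meta.) -/
namespace SimpleGraph

/-- An acyclic graph on a nonempty finite vertex set has fewer edges than vertices. -/
theorem IsAcyclic.ncard_edgeSet_lt_card {V : Type*} [Finite V] [Nonempty V]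
    {G : SimpleGraph V} (h : G.IsAcyclic) : G.edgeSet.ncard < Nat.card V := by
  obtain ⟨T, hGT, -, hT⟩ :=
    (connected_top (V := V)).exists_isTree_le_of_le_of_isAcyclic le_top h
  have hcard := (isTree_iff_connected_and_card.1 hT).2
  have hle : G.edgeSet.ncard ≤ T.edgeSet.ncard :=
    Set.ncard_le_ncard (edgeSet_mono hGT) (Set.toFinite _)
  rw [Nat.card_coe_set_eq] at hcard
  lia

theorem ncard_incidenceSet {V : Type*} (G : SimpleGraph V) (x : V) :
    (G.incidenceSet x).ncard = (G.neighborSet x).ncard := by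
  classical
  exact Nat.card_congr (G.incidenceSetEquivNeighborSet x)

/-- If every edge avoiding `x` lies inside `U`, then the edges of `G` are accounted for by those at
`x` and those of the graph induced on `U`. -/
theorem ncard_edgeSet_le_ncard_neighborSet_add {V : Type*} [Finite V] (G : SimpleGraph V)
    (x : V) (U : Set V) (hU : ∀ p q, G.Adj p q → p ≠ x → p ∈ U) :
    G.edgeSet.ncard ≤ (G.neighborSet x).ncard + (G.induce U).edgeSet.ncard := by
  have hsub : G.edgeSet ⊆
      G.incidenceSet x ∪ Sym2.map Subtype.val '' (G.induce U).edgeSet := by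
    intro e
    induction e with
    | h p q =>
      intro he
      by_cases hx : x ∈ s(p, q)
      · exact Or.inl ⟨he, hx⟩
      · rw [Sym2.mem_iff, not_or] at hx
        exact Or.inr ⟨s(⟨p, hU p q he (Ne.symm hx.1)⟩, ⟨q, hU q p he.symm (Ne.symm hx.2)⟩),
          he, rfl⟩
  calc G.edgeSet.ncard
      ≤ (G.incidenceSet x ∪ Sym2.map Subtype.val '' (G.induce U).edgeSet).ncard :=
        Set.ncard_le_ncard hsub (Set.toFinite _)
    _ ≤ (G.incidenceSet x).ncard + (Sym2.map Subtype.val '' (G.induce U).edgeSet).ncard :=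
        Set.ncard_union_le _ _
    _ ≤ _ := by
        rw [ncard_incidenceSet]
        gcongr
        exact Set.ncard_image_le (Set.toFinite _)

end SimpleGraph

/-- Key counting claim in the proof of correctness of Rule meta: in a graph `Q`
whose vertex set is `A ∪ {w1, w2}` and in which every vertex other than `w1`
has degree at most `|E(Q)| − |A| − 1`, every set `S` with `w1 ∉ S` whose removal
leaves an acyclic graph satisfies `|S ∩ (A ∪ {w1, w2})| ≥ 2`. -/
theorem stmt_3 {V : Type*} [Fintype V]
    (Q : SimpleGraph V) (A : Set V) (w1 w2 : V)
    (hw12 : w1 ≠ w2) (hw1A : w1 ∉ A) (hw2A : w2 ∉ A)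
    (hsupp : ∀ p q : V, Q.Adj p q → p ∈ A ∪ {w1, w2})
    (hdeg : ∀ x ∈ A ∪ ({w1, w2} : Set V), x ≠ w1 →
      ((Q.neighborSet x).ncard : ℤ) ≤ (Q.edgeSet.ncard : ℤ) - (A.ncard : ℤ) - 1)
    (S : Set V) (hw1S : w1 ∉ S)
    (hacyc : (Q.induce ((A ∪ {w1, w2}) \ S)).IsAcyclic) :
    2 ≤ (S ∩ (A ∪ {w1, w2})).ncard := by
  by_contra! hlt
  set W : Set V := A ∪ {w1, w2} with hW
  have hw1W : w1 ∈ W := by simp [hW]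
  obtain ⟨x, hxW, hxw1, hSx⟩ : ∃ x ∈ W, x ≠ w1 ∧ S ∩ W ⊆ {x} := by
    rcases (S ∩ W).eq_empty_or_nonempty with hempty | ⟨x, hxS, hxW⟩
    · exact ⟨w2, by simp [hW], hw12.symm, by simp [hempty]⟩
    · refine ⟨x, hxW, fun h ↦ hw1S (h ▸ hxS), fun y hy ↦ ?_⟩
      exact (Set.ncard_le_one (Set.toFinite _)).1 (Nat.le_of_lt_succ hlt) y hy x ⟨hxS, hxW⟩
  have hsub : W \ {x} ⊆ W \ S := fun y hy ↦ ⟨hy.1, fun hyS ↦ hy.2 (hSx ⟨hyS, hy.1⟩)⟩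
  have hac : (Q.induce (W \ {x})).IsAcyclic :=
    hacyc.embedding (SimpleGraph.induceHomOfLE Q hsub)
  have : Nonempty ↥(W \ {x}) := ⟨⟨w1, hw1W, hxw1.symm⟩⟩
  have hforest := hac.ncard_edgeSet_lt_card
  rw [Nat.card_coe_set_eq] at hforest
  have hWcard : (W \ {x}).ncard + 1 ≤ A.ncard + 2 := by
    rw [Set.ncard_sdiff_singleton_add_one hxW (Set.toFinite _), ← Set.ncard_pair hw12]
    exact Set.ncard_union_le _ _
  have hedges := Q.ncard_edgeSet_le_ncard_neighborSet_add x (W \ {x})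
    fun p q hpq hpx ↦ ⟨hsupp p q hpq, hpx⟩
  have := hdeg x hxW hxw1
  lia
end

section
/- Let G be a finite simple graph in which every vertex has degree at least 3, containing five distinct vertices v1, v2, u, w1, w2 such that: N(v1) = {v2, w1, w2}; both w1 and w2 are neighbors of u; v2 has at most one neighbor outside {w1, w2, v1}; and u has at most one neighbor outside {w1, w2}. Suppose moreover that G contains no digon:1+2:1 configuration. Then for every integer k ≥ 1, G has a feedback vertex set of size at most k if and only if G − w1 has a feedback vertex set of size at most k − 1. (Consequence of Lemma 6 together with the correctness of Rule meta, stated for simple graphs.) -/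
/-- A set `S` is a feedback vertex set of `G` if the subgraph induced on the
complement of `S` is acyclic. `HasFVS G k` means `G` has a feedback vertex set
of size at most `k`. -/
def HasFVS {V : Type*} (G : SimpleGraph V) (k : ℕ) : Prop :=
  ∃ S : Set V, S.ncard ≤ k ∧ (G.induce Sᶜ).IsAcyclic

/-- A digon:1+2:1 configuration in `G`: distinct vertices `a, b, p, q` together with
vertices `p', r, r'` such that `N(p) = {a, b, p'}`, `N(q) = {a, b, r}` and
`N(r) = {a, q, r'}`. -/
def HasDigonConfig {V : Type*} (G : SimpleGraph V) : Prop :=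
  ∃ a b p q p' r r' : V,
    a ≠ b ∧ a ≠ p ∧ a ≠ q ∧ b ≠ p ∧ b ≠ q ∧ p ≠ q ∧
    G.neighborSet p = {a, b, p'} ∧
    G.neighborSet q = {a, b, r} ∧
    G.neighborSet r = {a, q, r'}

namespace SimpleGraph

variable {V : Type*} {G : SimpleGraph V}

lemma isAcyclic_induce_mono {s t : Set V} (hst : s ⊆ t) (ht : (G.induce t).IsAcyclic) :
    (G.induce s).IsAcyclic :=
  ht.embedding (G.induceHomOfLE hst)

/-- A cycle of `G` cannot lie inside a vertex set inducing an acyclic subgraph. -/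
lemma IsAcyclic.not_isCycle_of_support_subset {t : Set V} (ht : (G.induce t).IsAcyclic) {v : V}
    (c : G.Walk v v) (hc : ∀ x ∈ c.support, x ∈ t) : ¬ c.IsCycle := fun hcyc ↦
  ht (c.induce t hc) <| Walk.IsCycle.of_map (f := (Embedding.induce t).toHom) <| by
    rwa [Walk.map_induce]

lemma IsAcyclic.not_triangle {t : Set V} (ht : (G.induce t).IsAcyclic) {a b c : V}
    (hab : G.Adj a b) (hbc : G.Adj b c) (hca : G.Adj c a) : ¬ (a ∈ t ∧ b ∈ t ∧ c ∈ t) := by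
  rintro ⟨ha, hb, hc⟩
  refine ht.not_isCycle_of_support_subset (.cons hab (.cons hbc (.cons hca .nil)))
    (by simp [ha, hb, hc]) ?_
  have := hab.ne
  have := hbc.ne
  have := hca.ne
  rw [Walk.cons_isCycle_iff]
  simp
  grind

lemma IsAcyclic.not_square {t : Set V} (ht : (G.induce t).IsAcyclic) {a b c d : V}
    (hab : G.Adj a b) (hbc : G.Adj b c) (hcd : G.Adj c d) (hda : G.Adj d a)
    (hac : a ≠ c) (hbd : b ≠ d) : ¬ (a ∈ t ∧ b ∈ t ∧ c ∈ t ∧ d ∈ t) := by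
  rintro ⟨ha, hb, hc, hd⟩
  refine ht.not_isCycle_of_support_subset (.cons hab (.cons hbc (.cons hcd (.cons hda .nil))))
    (by simp [ha, hb, hc, hd]) ?_
  have := hab.ne
  have := hbc.ne
  have := hcd.ne
  have := hda.ne
  rw [Walk.cons_isCycle_iff]
  simp
  grind

/-- Adding a vertex with at most one neighbour in `t` preserves acyclicity. -/
lemma isAcyclic_induce_insert {t : Set V} {x : V} (ht : (G.induce t).IsAcyclic)
    (hx : (G.neighborSet x ∩ t).Subsingleton) : (G.induce (insert x t)).IsAcyclic := by
  classical
  intro a c hc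
  by_cases hxc : (⟨x, Set.mem_insert x t⟩ : ↥(insert x t)) ∈ c.support
  · have hd := hc.rotate hxc
    set d := c.rotate _ hxc
    have h₁ := d.adj_snd hd.not_nil
    have h₂ := (d.adj_penultimate hd.not_nil).symm
    have mem {y : ↥(insert x t)} (h : (G.induce (insert x t)).Adj ⟨x, Set.mem_insert x t⟩ y) :
        (y : V) ∈ G.neighborSet x ∩ t :=
      ⟨h, y.2.resolve_left fun e ↦ h.ne (Subtype.ext e.symm)⟩
    exact hd.snd_ne_penultimate (Subtype.ext (hx (mem h₁) (mem h₂)))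
  · refine ht.not_isCycle_of_support_subset (c.map (Embedding.induce (insert x t)).toHom) ?_ ?_
    · intro y hy
      rw [Walk.support_map, List.mem_map] at hy
      obtain ⟨z, hz, rfl⟩ := hy
      exact z.2.resolve_left fun e ↦ hxc (by convert hz; exact e.symm)
    · exact (Walk.isCycle_map_iff_of_injective Subtype.val_injective).2 hc

end SimpleGraph

/-- Feedback vertex sets of `G - w` correspond to feedback vertex sets of `G` containing `w`. -/
lemma hasFVS_induce_compl_singleton_iff {V : Type*} [Finite V] {G : SimpleGraph V} {w : V} {k : ℕ}
    (hk : 1 ≤ k) :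
    HasFVS (G.induce ({w}ᶜ : Set V)) (k - 1) ↔
      ∃ S : Set V, w ∈ S ∧ S.ncard ≤ k ∧ (G.induce Sᶜ).IsAcyclic := by
  constructor
  · rintro ⟨S, hS, hac⟩
    refine ⟨insert w (Subtype.val '' S), Set.mem_insert _ _, ?_, ?_⟩
    · have h₁ := Set.ncard_insert_le w (Subtype.val '' S)
      have h₂ := Set.ncard_image_le (f := Subtype.val) (Set.toFinite S)
      omega
    · let f : G.induce (insert w (Subtype.val '' S))ᶜ →g
          (G.induce ({w}ᶜ : Set V)).induce Sᶜ :=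
        { toFun := fun x ↦ ⟨⟨x, fun e ↦ x.2 (Or.inl e)⟩, fun h ↦ x.2 (Or.inr ⟨_, h, rfl⟩)⟩
          map_rel' := fun h ↦ h }
      exact hac.comap f fun x y h ↦ Subtype.ext (congrArg (fun z ↦ z.1.1) h)
  · rintro ⟨S, hw, hS, hac⟩
    refine ⟨Subtype.val ⁻¹' S, ?_, ?_⟩
    · rw [← Set.ncard_image_of_injective _ Subtype.val_injective, Subtype.image_preimage_coe]
      have h₁ : ({w}ᶜ ∩ S : Set V) = S \ {w} := by grind
      rw [h₁, Set.ncard_sdiff_singleton_of_mem hw]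
      omega
    · let f : (G.induce ({w}ᶜ : Set V)).induce (Subtype.val ⁻¹' S)ᶜ →g G.induce Sᶜ :=
        { toFun := fun x ↦ ⟨x.1.1, x.2⟩
          map_rel' := fun h ↦ h }
      exact hac.comap f fun x y h ↦ Subtype.ext (Subtype.ext (congrArg (fun z ↦ z.1) h))

lemma Set.ncard_insert_sdiff_singleton_le {α : Type*} [Finite α] {s : Set α} {a : α} (ha : a ∈ s)
    (b : α) : (insert b (s \ {a})).ncard ≤ s.ncard := by
  have h₁ := Set.ncard_insert_le b (s \ {a})
  have h₂ := Set.ncard_sdiff_singleton_add_one ha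
  omega

/-- A vertex `r` adjacent to `q`, with at most one neighbour outside `{a, b, q}`, is adjacent to
both `a` and `b` unless the graph contains a digon:1+2:1 configuration. -/
lemma adj_of_not_hasDigonConfig {V : Type*} [Finite V] {G : SimpleGraph V} {a b p q r : V}
    (hdeg : ∀ z : V, 3 ≤ (G.neighborSet z).ncard) (hG : ¬ HasDigonConfig G)
    (hab : a ≠ b) (hpq : p ≠ q) (hpa : G.Adj p a) (hpb : G.Adj p b)
    (hq : G.neighborSet q = {r, a, b})
    (hp : (G.neighborSet p \ {a, b}).ncard ≤ 1) (hr : (G.neighborSet r \ {a, b, q}).ncard ≤ 1) :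
    G.Adj r b := by
  by_contra hrb
  obtain ⟨p', hp'⟩ : ∃ p', G.neighborSet p = {a, b, p'} := by
    have h₁ : ({a, b} : Set V) ⊆ G.neighborSet p := by simp [Set.pair_subset_iff, hpa, hpb]
    have h₂ := Set.ncard_sdiff_add_ncard_of_subset h₁
    have h₃ := Set.ncard_pair hab
    have h₄ := hdeg p
    obtain ⟨p', hp'⟩ := Set.ncard_eq_one.1 (show (G.neighborSet p \ {a, b}).ncard = 1 by omega)
    refine ⟨p', ?_⟩
    rw [← Set.sdiff_union_of_subset h₁, hp']
    grind
  obtain ⟨r', hr'⟩ : ∃ r', G.neighborSet r = {a, q, r'} := by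
    have hsub : G.neighborSet r \ {a, q} = G.neighborSet r \ {a, b, q} := by
      ext x
      have : x ∈ G.neighborSet r → x ≠ b := by
        rintro h rfl
        exact hrb h
      grind
    have haq : a ≠ q := by
      rintro rfl
      have : a ∈ G.neighborSet a := by simp [hq]
      exact G.irrefl this
    have h₃ := Set.ncard_pair haq
    have h₄ := hdeg r
    have h₁ : ({a, q} : Set V) ⊆ G.neighborSet r := by
      have h₅ := Set.ncard_inter_add_ncard_sdiff_eq_ncard (G.neighborSet r) {a, q}
      rw [hsub] at h₅
      have h₆ := Set.eq_of_subset_of_ncard_le (s := G.neighborSet r ∩ {a, q})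
        Set.inter_subset_right (by omega)
      exact Set.inter_eq_right.1 h₆
    have h₂ := Set.ncard_sdiff_add_ncard_of_subset h₁
    rw [hsub] at h₂
    obtain ⟨r', hr'⟩ := Set.ncard_eq_one.1 (show (G.neighborSet r \ {a, b, q}).ncard = 1 by omega)
    refine ⟨r', ?_⟩
    rw [← Set.sdiff_union_of_subset h₁, hsub, hr']
    grind
  have hqa : G.Adj q a := by simp [← SimpleGraph.mem_neighborSet, hq]
  have hqb : G.Adj q b := by simp [← SimpleGraph.mem_neighborSet, hq]
  exact hG ⟨a, b, p, q, p', r, r', hab, hpa.ne', hqa.ne', hpb.ne', hqb.ne', hpq, hp',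
    by rw [hq]; grind, hr'⟩

/-- Consequence of Lemma 6 together with the correctness of Rule meta,
stated for simple graphs. -/
theorem stmt_4 {V : Type*} [Fintype V]
    (G : SimpleGraph V)
    (hdeg3 : ∀ z : V, 3 ≤ (G.neighborSet z).ncard)
    (v1 v2 u w1 w2 : V)
    (h12 : v1 ≠ v2) (h1u : v1 ≠ u) (h1w1 : v1 ≠ w1) (h1w2 : v1 ≠ w2)
    (h2u : v2 ≠ u) (h2w1 : v2 ≠ w1) (h2w2 : v2 ≠ w2)
    (huw1 : u ≠ w1) (huw2 : u ≠ w2) (hw12 : w1 ≠ w2)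
    (hNv1 : G.neighborSet v1 = {v2, w1, w2})
    (huadj1 : G.Adj u w1) (huadj2 : G.Adj u w2)
    (hv2 : (G.neighborSet v2 \ {w1, w2, v1}).ncard ≤ 1)
    (hu : (G.neighborSet u \ {w1, w2}).ncard ≤ 1)
    (hnodigon : ¬ HasDigonConfig G)
    (k : ℕ) (hk : 1 ≤ k) :
    HasFVS G k ↔ HasFVS (G.induce ({w1}ᶜ : Set V)) (k - 1) := by
  have hmem : ∀ x, x ∈ G.neighborSet v1 ↔ x = v2 ∨ x = w1 ∨ x = w2 := by simp [hNv1]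
  have a12 : G.Adj v1 v2 := (hmem _).2 (by simp)
  have a1w1 : G.Adj v1 w1 := (hmem _).2 (by simp)
  have a1w2 : G.Adj v1 w2 := (hmem _).2 (by simp)
  have a2w2 : G.Adj v2 w2 :=
    adj_of_not_hasDigonConfig hdeg3 hnodigon hw12 h1u.symm huadj1 huadj2 hNv1 hu hv2
  have a2w1 : G.Adj v2 w1 := by
    refine adj_of_not_hasDigonConfig hdeg3 hnodigon hw12.symm h1u.symm huadj2 huadj1
      (by rw [hNv1, Set.pair_comm]) (by rwa [Set.pair_comm]) (by rwa [Set.insert_comm])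
  rw [hasFVS_induce_compl_singleton_iff hk]
  refine ⟨?_, fun ⟨S, _, hS⟩ ↦ ⟨S, hS⟩⟩
  rintro ⟨S, hS, hac⟩
  by_cases hw1 : w1 ∈ S
  · exact ⟨S, hw1, hS, hac⟩
  have tri₁ := hac.not_triangle a12 a2w1 a1w1.symm
  have sq₁ := hac.not_square a1w1 huadj1.symm huadj2 a1w2.symm h1u hw12
  have sq₂ := hac.not_square a2w1 huadj1.symm huadj2 a2w2.symm h2u hw12
  simp only [Set.mem_compl_iff] at tri₁ sq₁ sq₂
  refine ⟨insert w1 (insert w2 (S \ {v1, v2, u})), Set.mem_insert _ _, hS.trans' ?_, ?_⟩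
  · by_cases hw2 : w2 ∈ S
    · obtain ⟨y, hy, hyS⟩ : ∃ y, (y = v1 ∨ y = v2) ∧ y ∈ S := by grind
      exact (Set.ncard_le_ncard (by grind)).trans (Set.ncard_insert_sdiff_singleton_le hyS w1)
    · obtain ⟨y, z, hyz, hy, hz, hyS, hzS⟩ : ∃ y z, y ≠ z ∧ (y = v1 ∨ y = v2 ∨ y = u) ∧
          (z = v1 ∨ z = v2 ∨ z = u) ∧ y ∈ S ∧ z ∈ S := by grind
      have hz' : z ∈ insert w2 (S \ {y}) := by grind
      exact (Set.ncard_le_ncard (by grind)).trans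
        ((Set.ncard_insert_sdiff_singleton_le hz' w1).trans
          (Set.ncard_insert_sdiff_singleton_le hyS w2))
  · obtain ⟨T, hT⟩ : ∃ T : Set V, ∀ x, x ∈ T ↔
        x ∉ S ∧ x ≠ v1 ∧ x ≠ v2 ∧ x ≠ u ∧ x ≠ w1 ∧ x ≠ w2 := ⟨{x | _}, fun _ ↦ Iff.rfl⟩
    have hTac : (G.induce T).IsAcyclic :=
      SimpleGraph.isAcyclic_induce_mono (by grind) hac
    rw [Set.ncard_le_one_iff_subsingleton] at hu hv2
    have hTu := SimpleGraph.isAcyclic_induce_insert hTac (x := u) (hu.anti (by grind))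
    have hTv2 := SimpleGraph.isAcyclic_induce_insert hTu (x := v2) (hv2.anti (by grind))
    have hTv1 := SimpleGraph.isAcyclic_induce_insert hTv2 (x := v1)
      (Set.subsingleton_singleton (a := v2) |>.anti (by grind))
    exact SimpleGraph.isAcyclic_induce_mono (by grind) hTv1
end
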